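/- arXiv:1711.08909 — 6 statements merged into one kernel-verified Lean document; each statement's English description precedes it below -/
import Mathlib

section
/- Let L₂ = D_{W₂} − W₂ be the Laplacian of a strongly connected weighted digraph on m ≥ 2 nodes (W₂ nonnegative with zero diagonal and irreducible, D_{W₂} the diagonal of the row sums of W₂), and let D be a nonnegative diagonal m×m matrix with at least one positive diagonal entry. Then the matrix M = L₂ + D has a real eigenvalue μ > 0 that is algebraically simple, possesses entrywise positive left and right eigenvectors, and satisfies Re λ ≥ μ for every eigenvalue λ of M. In particular M is invertible. -/
open Matrix Finset

/-- The graph Laplacian `L = D_W - W` of a weighted digraph with weight matrix `W`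
(`W i j` is the weight of the link from node `j` to node `i`); `D_W` is the diagonal
matrix of the row sums. -/
noncomputable def lapl {m : ℕ} (W : Matrix (Fin m) (Fin m) ℝ) : Matrix (Fin m) (Fin m) ℝ :=
  Matrix.diagonal (fun i => ∑ j, W i j) - W

/-- A nonnegative matrix is irreducible (its digraph is strongly connected): every node
is reachable from every other node through a directed path. -/
def Irreducible' {m : ℕ} (A : Matrix (Fin m) (Fin m) ℝ) : Prop :=
  ∀ i j : Fin m, i ≠ j → ∃ k : ℕ, 0 < (A ^ k) i j

namespace Matrix

variable {n : Type*} [Fintype n]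

lemma mulVec_pos_of_pos {P : Matrix n n ℝ} (hP : ∀ i j, 0 < P i j) {v : n → ℝ}
    (hv : 0 ≤ v) (hv0 : v ≠ 0) (i : n) : 0 < (P *ᵥ v) i := by
  obtain ⟨j, hj⟩ := Function.ne_iff.1 hv0
  exact Finset.sum_pos' (fun k _ => mul_nonneg (hP i k).le (hv k))
    ⟨j, Finset.mem_univ j, mul_pos (hP i j) (lt_of_le_of_ne (hv j) (Ne.symm hj))⟩

lemma mulVec_nonneg_of_nonneg {B : Matrix n n ℝ} (hB : ∀ i j, 0 ≤ B i j) {v : n → ℝ}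
    (hv : 0 ≤ v) : 0 ≤ B *ᵥ v :=
  fun i => Finset.sum_nonneg fun k _ => mul_nonneg (hB i k) (hv k)

lemma pow_mulVec_eq_smul [DecidableEq n] {B : Matrix n n ℝ} {x : n → ℝ} {t : ℝ}
    (h : B *ᵥ x = t • x) (k : ℕ) : (B ^ k) *ᵥ x = t ^ k • x := by
  induction k with
  | zero => simp
  | succ k ih => rw [pow_succ, ← mulVec_mulVec, h, mulVec_smul, ih, smul_smul, pow_succ, mul_comm]

/-- A nonnegative eigenvector of a matrix with a positive power is positive. -/
lemma eigenvector_pos_of_pow_pos [DecidableEq n] {B : Matrix n n ℝ} {k : ℕ}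
    (hP : ∀ i j, 0 < (B ^ k) i j) {x : n → ℝ} {t : ℝ} (h : B *ᵥ x = t • x)
    (hx : 0 ≤ x) (hx0 : x ≠ 0) (i : n) : 0 < x i := by
  have h1 := mulVec_pos_of_pos hP hx hx0 i
  rw [pow_mulVec_eq_smul h] at h1
  refine lt_of_le_of_ne (hx i) fun h0 => ?_
  simp [← h0] at h1

/-- Perron's theorem: a nonnegative matrix with a positive power has a positive eigenvector
with nonnegative eigenvalue. -/
theorem exists_pos_eigenvector_of_pow_pos [DecidableEq n] [Nonempty n] {B : Matrix n n ℝ}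
    (hB : ∀ i j, 0 ≤ B i j) {k : ℕ} (hP : ∀ i j, 0 < (B ^ k) i j) :
    ∃ t : ℝ, 0 ≤ t ∧ ∃ x : n → ℝ, (∀ i, 0 < x i) ∧ B *ᵥ x = t • x := by
  set C : ℝ := ∑ i, ∑ j, B i j
  have bound : ∀ (t : ℝ) (x : n → ℝ), x ∈ stdSimplex ℝ n → (∀ i, t * x i ≤ (B *ᵥ x) i) →
      t ≤ C := by
    intro t x hx h
    calc t = ∑ i, t * x i := by rw [← Finset.mul_sum, hx.2, mul_one]
      _ ≤ ∑ i, (B *ᵥ x) i := Finset.sum_le_sum fun i _ => h i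
      _ ≤ C := Finset.sum_le_sum fun i _ => Finset.sum_le_sum fun j _ =>
          mul_le_of_le_one_right (hB i j) ((stdSimplex_subset_Icc ℝ hx).2 j)
  let K : Set (ℝ × (n → ℝ)) :=
    (Set.Icc 0 C ×ˢ stdSimplex ℝ n) ∩ {p | ∀ i, p.1 * p.2 i ≤ (B *ᵥ p.2) i}
  have hK : IsCompact K := by
    refine (isCompact_Icc.prod (isCompact_stdSimplex ℝ n)).inter_right ?_
    simp only [Set.ofPred_forall]
    refine isClosed_iInter fun i => isClosed_le (by fun_prop) ?_
    simp only [mulVec, dotProduct]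
    fun_prop
  have hne : K.Nonempty := by
    obtain ⟨i⟩ := ‹Nonempty n›
    have hs := single_mem_stdSimplex ℝ i
    have h0 : ∀ j, (0 : ℝ) * (Pi.single i 1 : n → ℝ) j ≤ (B *ᵥ Pi.single i 1) j := fun j => by
      rw [zero_mul]; exact mulVec_nonneg_of_nonneg hB (fun j => hs.1 j) j
    exact ⟨(0, Pi.single i 1), ⟨⟨⟨le_rfl, bound 0 _ hs h0⟩, hs⟩, h0⟩⟩
  obtain ⟨⟨t, x⟩, ⟨⟨ht, hx⟩, hle⟩, hmax⟩ := hK.exists_isMaxOn hne continuous_fst.continuousOn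
  simp only [Set.mem_ofPred_eq] at ht hx hle
  have hx0 : x ≠ 0 := by
    rintro rfl
    simpa using hx.2
  have hxn : 0 ≤ x := hx.1
  have heq : B *ᵥ x = t • x := by
    by_contra hneq
    have hgap : ∀ i, 0 < ((B ^ k) *ᵥ (B *ᵥ x - t • x)) i :=
      mulVec_pos_of_pos hP (fun i => by simpa using hle i) (sub_ne_zero.2 hneq)
    set y := (B ^ k) *ᵥ x with hy
    have hypos : ∀ i, 0 < y i := mulVec_pos_of_pos hP hxn hx0
    have hgap' : ∀ i, t * y i < (B *ᵥ y) i := fun i => by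
      have := hgap i
      rw [mulVec_sub, mulVec_mulVec, ← pow_succ, pow_succ', ← mulVec_mulVec, mulVec_smul, ← hy] at this
      exact sub_pos.1 this
    obtain ⟨i₀, hi₀⟩ := Finite.exists_min fun i => (B *ᵥ y) i / y i
    set s := (B *ᵥ y) i₀ / y i₀
    have hts : t < s := (lt_div_iff₀ (hypos i₀)).2 (hgap' i₀)
    set c := ∑ i, y i
    have hc : 0 < c := Finset.sum_pos (fun i _ => hypos i) Finset.univ_nonempty
    have hz : c⁻¹ • y ∈ stdSimplex ℝ n :=
      ⟨fun i => (mul_pos (inv_pos.2 hc) (hypos i)).le, by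
        simp only [Pi.smul_apply, smul_eq_mul, ← Finset.mul_sum]
        exact inv_mul_cancel₀ hc.ne'⟩
    have hzle : ∀ i, s * (c⁻¹ • y) i ≤ (B *ᵥ (c⁻¹ • y)) i := fun i => by
      have := (le_div_iff₀ (hypos i)).1 (hi₀ i)
      rw [mulVec_smul]
      simp only [Pi.smul_apply, smul_eq_mul]
      rw [mul_left_comm]
      exact mul_le_mul_of_nonneg_left this (inv_pos.2 hc).le
    have : s ≤ t := hmax (show (s, c⁻¹ • y) ∈ K from
      ⟨⟨⟨ht.1.trans hts.le, bound s _ hz hzle⟩, hz⟩, hzle⟩)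
    exact absurd hts this.not_gt
  exact ⟨t, ht.1, x, eigenvector_pos_of_pow_pos hP heq hxn hx0, heq⟩

/-- The eigenspace of a positive eigenvector of a matrix with a positive power is a line. -/
lemma eigenvector_eq_smul_of_pow_pos [DecidableEq n] [Nonempty n] {B : Matrix n n ℝ} {k : ℕ}
    (hP : ∀ i j, 0 < (B ^ k) i j) {x v : n → ℝ} {t : ℝ} (hx : ∀ i, 0 < x i)
    (h : B *ᵥ x = t • x) (hv : B *ᵥ v = t • v) : ∃ a : ℝ, v = a • x := by
  obtain ⟨i₀, hi₀⟩ := Finite.exists_min fun i => v i / x i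
  refine ⟨v i₀ / x i₀, ?_⟩
  by_contra hne
  have hnn : 0 ≤ v - (v i₀ / x i₀) • x := fun i => by
    simpa using (le_div_iff₀ (hx i)).1 (hi₀ i)
  have heq : B *ᵥ (v - (v i₀ / x i₀) • x) = t • (v - (v i₀ / x i₀) • x) := by
    rw [mulVec_sub, mulVec_smul, h, hv, smul_sub, smul_comm]
  have := eigenvector_pos_of_pow_pos hP heq hnn (sub_ne_zero.2 hne) i₀
  simp [(hx i₀).ne'] at this

/-- A nonnegative matrix with a positive left eigenvector has its spectral radius bounded by the
corresponding eigenvalue. -/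
lemma norm_le_of_pos_left_eigenvector {B : Matrix n n ℝ} (hB : ∀ i j, 0 ≤ B i j)
    {w : n → ℝ} {t : ℝ} (hw : ∀ i, 0 < w i) (h : w ᵥ* B = t • w) {z : ℂ} {v : n → ℂ}
    (hv0 : v ≠ 0) (hv : B.map Complex.ofReal *ᵥ v = z • v) : ‖z‖ ≤ t := by
  have hle : ∀ i, ‖z‖ * ‖v i‖ ≤ (B *ᵥ fun j => ‖v j‖) i := fun i => by
    rw [← norm_mul, ← smul_eq_mul, ← Pi.smul_apply, ← hv]
    refine (norm_sum_le _ _).trans_eq (Finset.sum_congr rfl fun j _ => ?_)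
    simp [abs_of_nonneg (hB i j)]
  have hpos : 0 < w ⬝ᵥ fun j => ‖v j‖ := by
    obtain ⟨j, hj⟩ := Function.ne_iff.1 hv0
    exact Finset.sum_pos' (fun i _ => mul_nonneg (hw i).le (norm_nonneg _))
      ⟨j, Finset.mem_univ j, mul_pos (hw j) (norm_pos_iff.2 hj)⟩
  refine le_of_mul_le_mul_right ?_ hpos
  calc ‖z‖ * (w ⬝ᵥ fun j => ‖v j‖) = w ⬝ᵥ (fun j => ‖z‖ * ‖v j‖) := by
        rw [← smul_eq_mul, ← dotProduct_smul]; rfl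
    _ ≤ w ⬝ᵥ (B *ᵥ fun j => ‖v j‖) :=
        Finset.sum_le_sum fun i _ => mul_le_mul_of_nonneg_left (hle i) (hw i).le
    _ = t * (w ⬝ᵥ fun j => ‖v j‖) := by
        rw [dotProduct_mulVec, h, smul_dotProduct, smul_eq_mul]

lemma dotProduct_pos_of_pos [Nonempty n] {w x : n → ℝ} (hw : ∀ i, 0 < w i) (hx : ∀ i, 0 < x i) :
    0 < w ⬝ᵥ x :=
  Finset.sum_pos (fun i _ => mul_pos (hw i) (hx i)) Finset.univ_nonempty

/-- An eigenvalue with a one-dimensional eigenspace, whose left and right eigenvectors are not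
orthogonal, is algebraically simple. -/
lemma rootMultiplicity_charpoly_eq_one [DecidableEq n] {M : Matrix n n ℝ} {μ : ℝ} {w x : n → ℝ}
    (hwx : w ⬝ᵥ x ≠ 0) (hw : w ᵥ* M = μ • w) (hx : M *ᵥ x = μ • x)
    (huniq : ∀ v, M *ᵥ v = μ • v → ∃ a : ℝ, v = a • x) :
    M.charpoly.rootMultiplicity μ = 1 := by
  have hx0 : x ≠ 0 := by
    rintro rfl
    simp at hwx
  have hsub : ∀ v, (M.toLin' - algebraMap ℝ (Module.End ℝ (n → ℝ)) μ) v = M *ᵥ v - μ • v :=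
    fun v => by simp [Module.algebraMap_end_apply]
  have key : ∀ k : ℕ, ∀ v, ((M.toLin' - algebraMap ℝ (Module.End ℝ (n → ℝ)) μ) ^ k) v = 0 →
      ∃ a : ℝ, v = a • x := by
    intro k
    induction k with
    | zero => exact fun v hv => ⟨0, by simpa using hv⟩
    | succ k ih =>
      intro v hv
      rw [pow_succ, Module.End.mul_apply] at hv
      obtain ⟨a, ha⟩ := ih _ hv
      rw [hsub] at ha
      have h0 : a * (w ⬝ᵥ x) = 0 := by
        rw [← smul_eq_mul, ← dotProduct_smul, ← ha, dotProduct_sub, dotProduct_mulVec, hw,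
          smul_dotProduct, dotProduct_smul, sub_self]
      have ha0 : a = 0 := (mul_eq_zero.1 h0).resolve_right hwx
      exact huniq v (sub_eq_zero.1 (by rw [ha, ha0, zero_smul]))
  have hspan : Module.End.maxGenEigenspace M.toLin' μ = Submodule.span ℝ {x} := by
    ext v
    rw [Module.End.mem_maxGenEigenspace, Submodule.mem_span_singleton]
    constructor
    · rintro ⟨k, hk⟩
      obtain ⟨a, ha⟩ := key k v hk
      exact ⟨a, ha.symm⟩
    · rintro ⟨a, rfl⟩
      refine ⟨1, ?_⟩
      simp [hx]
  rw [← charpoly_toLin', ← LinearMap.finrank_maxGenEigenspace_eq, hspan, finrank_span_singleton hx0]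

/-- Entries of powers only grow when a nonnegative matrix is enlarged. -/
lemma pow_apply_le_pow_apply [DecidableEq n] {A B : Matrix n n ℝ} (hA : ∀ i j, 0 ≤ A i j)
    (hAB : ∀ i j, A i j ≤ B i j) (k : ℕ) (i j : n) : (A ^ k) i j ≤ (B ^ k) i j := by
  induction k generalizing i j with
  | zero => simp
  | succ k ih =>
    rw [pow_succ, pow_succ, mul_apply, mul_apply]
    exact Finset.sum_le_sum fun l _ => mul_le_mul (ih i l) (hAB l j) (hA l j)
      ((pow_apply_nonneg hA k i l).trans (ih i l))

lemma pow_apply_pos_of_le [DecidableEq n] {B : Matrix n n ℝ} (hB : ∀ i j, 0 ≤ B i j)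
    (hdiag : ∀ i, 0 < B i i) {i j : n} {k l : ℕ} (hkl : k ≤ l) (h : 0 < (B ^ k) i j) :
    0 < (B ^ l) i j := by
  induction l, hkl using Nat.le_induction with
  | base => exact h
  | succ l _ ih =>
    rw [pow_succ, mul_apply]
    exact Finset.sum_pos' (fun a _ => mul_nonneg (pow_apply_nonneg hB l i a) (hB a j))
      ⟨j, Finset.mem_univ j, mul_pos ih (hdiag j)⟩

end Matrix

lemma Irreducible'.exists_pow_pos {m : ℕ} {W B : Matrix (Fin m) (Fin m) ℝ}
    (hirr : Irreducible' W) (hW : ∀ i j, 0 ≤ W i j) (hWB : ∀ i j, W i j ≤ B i j)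
    (hdiag : ∀ i, 0 < B i i) : ∃ k : ℕ, ∀ i j, 0 < (B ^ k) i j := by
  have hB : ∀ i j, 0 ≤ B i j := fun i j => (hW i j).trans (hWB i j)
  have : ∀ i j, ∃ k : ℕ, 0 < (B ^ k) i j := fun i j => by
    rcases eq_or_ne i j with rfl | hij
    · exact ⟨0, by simp⟩
    · obtain ⟨k, hk⟩ := hirr i j hij
      exact ⟨k, hk.trans_le (Matrix.pow_apply_le_pow_apply hW hWB k i j)⟩
  choose k hk using this
  refine ⟨∑ i, ∑ j, k i j, fun i j => Matrix.pow_apply_pos_of_le hB hdiag ?_ (hk i j)⟩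
  exact (Finset.single_le_sum (f := fun j => k i j) (fun _ _ => Nat.zero_le _)
    (Finset.mem_univ j)).trans (Finset.single_le_sum (f := fun i => ∑ j, k i j)
      (fun _ _ => Nat.zero_le _) (Finset.mem_univ i))

/-- for the Laplacian `L₂` of a strongly connected weighted digraph on
`m ≥ 2` nodes and a nonnegative nonzero diagonal matrix `D`, the matrix `M = L₂ + D`
has a real eigenvalue `μ > 0` which is algebraically simple, has entrywise positive left
and right eigenvectors, and satisfies `Re λ ≥ μ` for every eigenvalue `λ` of `M`;
in particular `M` is invertible. -/
theorem stmt9 {m : ℕ} (hm : 2 ≤ m) (W₂ : Matrix (Fin m) (Fin m) ℝ)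
    (hnn : ∀ i j, 0 ≤ W₂ i j) (hdiag : ∀ i, W₂ i i = 0)
    (hirr : Irreducible' W₂)
    (d : Fin m → ℝ) (hd : ∀ i, 0 ≤ d i) (hd0 : ∃ i, 0 < d i) :
    ∃ μ : ℝ, 0 < μ ∧
      μ ∈ spectrum ℝ (lapl W₂ + Matrix.diagonal d) ∧
      Polynomial.rootMultiplicity μ (lapl W₂ + Matrix.diagonal d).charpoly = 1 ∧
      (∃ w : Fin m → ℝ, (∀ i, 0 < w i) ∧
        Matrix.vecMul w (lapl W₂ + Matrix.diagonal d) = μ • w) ∧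
      (∃ y : Fin m → ℝ, (∀ i, 0 < y i) ∧
        (lapl W₂ + Matrix.diagonal d).mulVec y = μ • y) ∧
      (∀ z : ℂ, z ∈ spectrum ℂ ((lapl W₂ + Matrix.diagonal d).map Complex.ofReal) →
        μ ≤ z.re) ∧
      IsUnit (lapl W₂ + Matrix.diagonal d) := by
  have : NeZero m := ⟨by omega⟩
  set M := lapl W₂ + Matrix.diagonal d with hM
  set r : Fin m → ℝ := fun i => (∑ j, W₂ i j) + d i
  have hr0 : ∀ i, 0 ≤ r i := fun i => add_nonneg (Finset.sum_nonneg fun j _ => hnn i j) (hd i)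
  set c : ℝ := 1 + ∑ i, r i
  have hrc : ∀ i, 0 < c - r i := fun i => by
    have := Finset.single_le_sum (fun i _ => hr0 i) (Finset.mem_univ i)
    linarith
  set B : Matrix (Fin m) (Fin m) ℝ := W₂ + Matrix.diagonal fun i => c - r i with hBdef
  have hMB : M = c • (1 : Matrix (Fin m) (Fin m) ℝ) - B := by
    ext i j
    rcases eq_or_ne i j with rfl | hij
    · simp [hM, hBdef, lapl, r]
      ring
    · simp [hM, hBdef, lapl, hij]
  have hWB : ∀ i j, W₂ i j ≤ B i j := fun i j => by
    rcases eq_or_ne i j with rfl | hij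
    · simpa [hBdef] using (hrc i).le
    · simp [hBdef, hij]
  have hB : ∀ i j, 0 ≤ B i j := fun i j => (hnn i j).trans (hWB i j)
  obtain ⟨k, hP⟩ := hirr.exists_pow_pos hnn hWB fun i => by simpa [hBdef, hdiag] using hrc i
  obtain ⟨ρ, -, y, hy, hBy⟩ := Matrix.exists_pos_eigenvector_of_pow_pos hB hP
  obtain ⟨ρ', -, w, hw, hBw⟩ := Matrix.exists_pos_eigenvector_of_pow_pos (B := Bᵀ)
    (fun i j => hB j i) (k := k) (fun i j => by rw [← Matrix.transpose_pow]; exact hP j i)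
  rw [Matrix.mulVec_transpose] at hBw
  have hwy := Matrix.dotProduct_pos_of_pos hw hy
  obtain rfl : ρ = ρ' := by
    have := Matrix.dotProduct_mulVec w B y
    rw [hBw, hBy, smul_dotProduct, dotProduct_smul] at this
    exact mul_right_cancel₀ hwy.ne' this
  have hMv : ∀ v, M *ᵥ v = c • v - B *ᵥ v := fun v => by
    rw [hMB, Matrix.sub_mulVec, Matrix.smul_mulVec, Matrix.one_mulVec]
  have hMy : M *ᵥ y = (c - ρ) • y := by rw [hMv, hBy, sub_smul]
  have hMw : w ᵥ* M = (c - ρ) • w := by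
    rw [hMB, Matrix.vecMul_sub, Matrix.vecMul_smul, Matrix.vecMul_one, hBw, sub_smul]
  have hMone : M *ᵥ (fun _ => 1) = d := by
    ext i
    simp [hM, lapl, Matrix.mulVec, dotProduct, Matrix.diagonal_apply, Finset.sum_add_distrib]
  have hμ : 0 < c - ρ := by
    have h1 := Matrix.dotProduct_mulVec w M fun _ => 1
    rw [hMone, hMw, smul_dotProduct, smul_eq_mul] at h1
    have h2 : 0 < w ⬝ᵥ d := by
      obtain ⟨i, hi⟩ := hd0
      exact Finset.sum_pos' (fun i _ => mul_nonneg (hw i).le (hd i))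
        ⟨i, Finset.mem_univ i, mul_pos (hw i) hi⟩
    rw [h1] at h2
    exact pos_of_mul_pos_left h2
      (Matrix.dotProduct_pos_of_pos hw fun _ => one_pos).le
  have hmult : M.charpoly.rootMultiplicity (c - ρ) = 1 := by
    refine Matrix.rootMultiplicity_charpoly_eq_one hwy.ne' hMw hMy fun v hv => ?_
    refine Matrix.eigenvector_eq_smul_of_pow_pos hP hy hBy ?_
    rw [hMv, sub_smul] at hv
    exact sub_right_injective hv
  have hspec : ∀ z : ℂ, z ∈ spectrum ℂ (M.map Complex.ofReal) → c - ρ ≤ z.re := by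
    intro z hz
    rw [← Matrix.spectrum_toLin', ← Module.End.hasEigenvalue_iff_mem_spectrum] at hz
    obtain ⟨v, hv⟩ := hz.exists_hasEigenvector
    have hv1 : M.map Complex.ofReal *ᵥ v = z • v := by simpa using hv.apply_eq_smul
    have hBC : B.map Complex.ofReal = (c : ℂ) • 1 - M.map Complex.ofReal := by
      rw [hMB]
      ext i j
      rcases eq_or_ne i j with rfl | hij <;> simp [*]
    have hv2 : B.map Complex.ofReal *ᵥ v = ((c : ℂ) - z) • v := by
      rw [hBC, Matrix.sub_mulVec, Matrix.smul_mulVec, Matrix.one_mulVec, hv1, sub_smul]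
    have h1 := Matrix.norm_le_of_pos_left_eigenvector hB hw hBw hv.2 hv2
    have h2 := (Complex.re_le_norm _).trans h1
    simp only [Complex.sub_re, Complex.ofReal_re] at h2
    linarith
  refine ⟨c - ρ, hμ, ?_, hmult, ⟨w, hw, hMw⟩, ⟨y, hy, hMy⟩, hspec, ?_⟩
  · rw [Matrix.mem_spectrum_iff_isRoot_charpoly]
    exact (Polynomial.rootMultiplicity_pos'.1 (hmult ▸ one_pos)).2
  · rw [Matrix.isUnit_iff_isUnit_det, isUnit_iff_ne_zero]
    intro hdet
    have h0 : (0 : ℂ) ∈ spectrum ℂ (M.map Complex.ofReal) := by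
      rw [spectrum.zero_mem_iff, Matrix.isUnit_iff_isUnit_det, isUnit_iff_ne_zero, not_not]
      have := Complex.ofRealHom.map_det M
      rw [hdet, map_zero] at this
      exact this.symm
    exact absurd (hspec 0 h0) (by simpa using hμ)
end

section
/- Let L_W = [[L₁, 0], [−C, L₂ + D_C]] be the Laplacian of a weakly connected weighted digraph consisting of two strongly connected components joined by a cutset: L₁ ∈ ℝ^{n×n} and L₂ ∈ ℝ^{m×m} are Laplacians of strongly connected weighted digraphs, C ∈ ℝ^{m×n} is nonnegative with at least one positive entry, and D_C is the diagonal matrix of the row sums of C. Let μ be the minimal (simple, real, positive) eigenvalue of L₂ + D_C, with left eigenvector w (wᵀ(L₂+D_C) = μwᵀ) and right eigenvector y ((L₂+D_C)y = μy), and assume μ is not an eigenvalue of L₁. Then μ is a simple eigenvalue of L_W, the row vector (wᵀC(L₁ − μI)^{−1}, wᵀ) is a left eigenvector of L_W for μ, and the column vector (0, y) is a right eigenvector of L_W for μ. -/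
open Matrix Finset

namespace Matrix

variable {K p q : Type*} [Field K] [Fintype p] [Fintype q]

/-- If `μ` is not an eigenvalue of the upper left block of a block lower triangular matrix, then its
multiplicity is the one it has in the lower right block. -/
theorem rootMultiplicity_charpoly_fromBlocks_zero₁₂ [DecidableEq p] [DecidableEq q]
    (A : Matrix p p K) (B : Matrix q p K) (D : Matrix q q K) {μ : K} (hA : μ ∉ spectrum K A) :
    (fromBlocks A 0 B D).charpoly.rootMultiplicity μ = D.charpoly.rootMultiplicity μ := by
  rw [mem_spectrum_iff_isRoot_charpoly] at hA
  rw [charpoly_fromBlocks_zero₁₂, Polynomial.rootMultiplicity_mul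
    (mul_ne_zero A.charpoly_monic.ne_zero D.charpoly_monic.ne_zero),
    Polynomial.rootMultiplicity_eq_zero hA, zero_add]

/-- A left eigenvector of the lower right block of a block lower triangular matrix extends to the
whole matrix when the eigenvalue is not one of the upper left block. -/
theorem vecMul_fromBlocks_zero₁₂_of_vecMul_eq_smul [DecidableEq p] (A : Matrix p p K)
    (C : Matrix q p K) (D : Matrix q q K) {μ : K} {w : q → K}
    (hA : μ ∉ spectrum K A) (hw : w ᵥ* D = μ • w) :
    Sum.elim (w ᵥ* C ᵥ* (A - μ • (1 : Matrix p p K))⁻¹) w ᵥ* fromBlocks A 0 (-C) D =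
      μ • Sum.elim (w ᵥ* C ᵥ* (A - μ • (1 : Matrix p p K))⁻¹) w := by
  have hunit : IsUnit (A - μ • (1 : Matrix p p K)) := by
    rw [spectrum.notMem_iff, Algebra.algebraMap_eq_smul_one] at hA
    simpa using hA.neg
  set v := w ᵥ* C ᵥ* (A - μ • (1 : Matrix p p K))⁻¹ with hv
  have hvA : v ᵥ* A - μ • v = w ᵥ* C := by
    have h : v ᵥ* (A - μ • (1 : Matrix p p K)) = w ᵥ* C := by
      rw [hv, vecMul_vecMul, nonsing_inv_mul _ ((isUnit_iff_isUnit_det _).mp hunit), vecMul_one]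
    simpa [vecMul_sub, vecMul_smul] using h
  rw [vecMul_fromBlocks]
  ext (i | i)
  · simp [← hvA, vecMul_neg]
  · simp [hw]

/-- A right eigenvector of the lower right block of a block lower triangular matrix, extended by
zero, is a right eigenvector of the whole matrix. -/
theorem fromBlocks_zero₁₂_mulVec_of_mulVec_eq_smul (A : Matrix p p K) (B : Matrix q p K)
    (D : Matrix q q K) {μ : K} {y : q → K} (hy : D *ᵥ y = μ • y) :
    fromBlocks A 0 B D *ᵥ Sum.elim (0 : p → K) y = μ • Sum.elim (0 : p → K) y := by
  rw [fromBlocks_mulVec]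
  ext (i | i) <;> simp [hy]

end Matrix

/-- for the block Laplacian `L_W = [[L₁, 0], [-C, L₂ + D_C]]` of a weakly
connected digraph made of two strongly connected components joined by a cutset `C`,
if `μ` is the minimal (simple, real, positive) eigenvalue of `L₂ + D_C` with positive
left/right eigenvectors `w`, `y`, and `μ` is not an eigenvalue of `L₁`, then `μ` is a
simple eigenvalue of `L_W` with left eigenvector `(wᵀ C (L₁ - μI)⁻¹, wᵀ)` and right
eigenvector `(0, y)`. -/
theorem stmt10 {n m : ℕ}
    (W₁ : Matrix (Fin n) (Fin n) ℝ) (W₂ : Matrix (Fin m) (Fin m) ℝ)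
    (hW₁nn : ∀ i j, 0 ≤ W₁ i j) (hW₁diag : ∀ i, W₁ i i = 0) (hW₁irr : Irreducible' W₁)
    (hW₂nn : ∀ i j, 0 ≤ W₂ i j) (hW₂diag : ∀ i, W₂ i i = 0) (hW₂irr : Irreducible' W₂)
    (C : Matrix (Fin m) (Fin n) ℝ)
    (hCnn : ∀ i j, 0 ≤ C i j) (hC0 : ∃ i j, 0 < C i j)
    (μ : ℝ) (w y : Fin m → ℝ)
    (hμpos : 0 < μ)
    (hμsimple : Polynomial.rootMultiplicity μ
      (lapl W₂ + Matrix.diagonal (fun i => ∑ j, C i j)).charpoly = 1)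
    (hμmin : ∀ z : ℂ, z ∈ spectrum ℂ
      ((lapl W₂ + Matrix.diagonal (fun i => ∑ j, C i j)).map Complex.ofReal) → μ ≤ z.re)
    (hw : ∀ i, 0 < w i) (hy : ∀ i, 0 < y i)
    (hwEig : Matrix.vecMul w (lapl W₂ + Matrix.diagonal (fun i => ∑ j, C i j)) = μ • w)
    (hyEig : (lapl W₂ + Matrix.diagonal (fun i => ∑ j, C i j)).mulVec y = μ • y)
    (hμL₁ : μ ∉ spectrum ℝ (lapl W₁)) :
    Polynomial.rootMultiplicity μ
      (Matrix.fromBlocks (lapl W₁) 0 (-C)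
        (lapl W₂ + Matrix.diagonal (fun i => ∑ j, C i j))).charpoly = 1 ∧
    Matrix.vecMul
      (Sum.elim (Matrix.vecMul (Matrix.vecMul w C) ((lapl W₁ - μ • (1 : Matrix (Fin n) (Fin n) ℝ))⁻¹)) w)
      (Matrix.fromBlocks (lapl W₁) 0 (-C)
        (lapl W₂ + Matrix.diagonal (fun i => ∑ j, C i j)))
      = μ • Sum.elim (Matrix.vecMul (Matrix.vecMul w C) ((lapl W₁ - μ • (1 : Matrix (Fin n) (Fin n) ℝ))⁻¹)) w ∧
    (Matrix.fromBlocks (lapl W₁) 0 (-C)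
        (lapl W₂ + Matrix.diagonal (fun i => ∑ j, C i j))).mulVec (Sum.elim (0 : Fin n → ℝ) y)
      = μ • Sum.elim (0 : Fin n → ℝ) y := by
  refine ⟨?_, ?_, ?_⟩
  · rw [Matrix.rootMultiplicity_charpoly_fromBlocks_zero₁₂ _ _ _ hμL₁, hμsimple]
  · exact Matrix.vecMul_fromBlocks_zero₁₂_of_vecMul_eq_smul _ _ _ hμL₁ hwEig
  · exact Matrix.fromBlocks_zero₁₂_mulVec_of_mulVec_eq_smul _ _ _ hyEig
end

section
/- Let L_W = [[L₁, 0], [−C, L₂ + D_C]] be the block Laplacian of a weakly connected digraph with two strongly connected components joined by the cutset C (C ∈ ℝ^{m×n} nonnegative with at least one positive entry, D_C the diagonal of the row sums of C), and let μ > 0 be the minimal eigenvalue of L₂ + D_C. Suppose the spectral gap λ₂ of L_W is an eigenvalue of L₁, i.e. Re λ₂ < μ. Then for every nonnegative matrix Δ ∈ ℝ^{m×n}, the perturbed Laplacian L_p(Δ) = [[L₁, 0], [−C − Δ, L₂ + D_C + D_Δ]] (D_Δ the diagonal of the row sums of Δ) has the same spectral gap as L_W: min{Re λ : λ a nonzero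 eigenvalue of L_p(Δ)} = min{Re λ : λ a nonzero eigenvalue of L_W}. That is, the network's synchronizability is invariant under arbitrary structural perturbations in direction of the cutset. -/
open Matrix Finset

/-- The spectral gap of a Laplacian matrix: the minimum of `Re λ` over its nonzero
(complex) eigenvalues `λ`. -/
noncomputable def spectralGap {ι : Type*} [Fintype ι] [DecidableEq ι]
    (L : Matrix ι ι ℝ) : ℝ :=
  sInf {r : ℝ | ∃ z ∈ spectrum ℂ (L.map Complex.ofReal), z ≠ 0 ∧ z.re = r}

namespace Matrix

theorem mem_spectrum_iff_det_eq_zero {K ι : Type*} [Field K] [Fintype ι] [DecidableEq ι]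
    {A : Matrix ι ι K} {z : K} : z ∈ spectrum K A ↔ (A - z • 1).det = 0 := by
  rw [spectrum.mem_iff, ← IsUnit.neg_iff, neg_sub, Algebra.algebraMap_eq_smul_one,
    isUnit_iff_isUnit_det, isUnit_iff_ne_zero, not_not]

theorem spectrum_fromBlocks_zero₁₂ {K ι κ : Type*} [Field K] [Fintype ι] [Fintype κ]
    [DecidableEq ι] [DecidableEq κ] (A : Matrix ι ι K) (C : Matrix κ ι K) (B : Matrix κ κ K) :
    spectrum K (fromBlocks A 0 C B) = spectrum K A ∪ spectrum K B := by
  ext z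
  have h : fromBlocks A 0 C B - z • 1 = fromBlocks (A - z • 1) 0 C (B - z • 1) := by
    rw [← fromBlocks_one, fromBlocks_smul, sub_eq_add_neg, fromBlocks_neg, fromBlocks_add]
    simp [sub_eq_add_neg]
  simp only [Set.mem_union, mem_spectrum_iff_det_eq_zero]
  rw [h, det_fromBlocks_zero₁₂, mul_eq_zero]

theorem ofReal_mem_spectrum_map_iff {ι : Type*} [Fintype ι] [DecidableEq ι]
    {A : Matrix ι ι ℝ} {t : ℝ} :
    (t : ℂ) ∈ spectrum ℂ (A.map Complex.ofReal) ↔ (A - t • 1).det = 0 := by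
  have h : A.map Complex.ofReal - (t : ℂ) • 1 = (A - t • 1).map Complex.ofRealHom := by
    ext i j
    by_cases hij : i = j <;> simp [hij]
  rw [mem_spectrum_iff_det_eq_zero, h, ← RingHom.mapMatrix_apply, ← RingHom.map_det]
  simp

/-- A supersolution bound: if the off-diagonal entries of `A` are nonpositive and a positive
vector `v` satisfies `t v ≤ A v`, then every eigenvalue of `A` has real part at least `t`. -/
theorem le_re_of_mem_spectrum_of_smul_le_mulVec {ι : Type*} [Fintype ι] [DecidableEq ι]
    {A : Matrix ι ι ℝ} (hA : ∀ i j, i ≠ j → A i j ≤ 0) {v : ι → ℝ} (hv : ∀ i, 0 < v i)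
    {t : ℝ} (hAv : ∀ i, t * v i ≤ (A *ᵥ v) i) {z : ℂ}
    (hz : z ∈ spectrum ℂ (A.map Complex.ofReal)) : t ≤ z.re := by
  rw [mem_spectrum_iff_det_eq_zero, ← exists_mulVec_eq_zero_iff] at hz
  obtain ⟨x, hx0, hx⟩ := hz
  obtain ⟨k, hk⟩ := Function.ne_iff.1 hx0
  obtain ⟨i, -, hi⟩ := exists_max_image univ (fun i => ‖x i‖ / v i) ⟨k, mem_univ k⟩
  have hxi : 0 < ‖x i‖ / v i := (div_pos (norm_pos_iff.2 hk) (hv k)).trans_le (hi k (mem_univ k))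
  set r := ‖x i‖ / v i with hr
  have hxr : ∀ j, ‖x j‖ ≤ r * v j := fun j => (div_le_iff₀ (hv j)).1 (hi j (mem_univ j))
  have hxir : ‖x i‖ = r * v i := by rw [hr, div_mul_cancel₀ _ (hv i).ne']
  have hsum : (z - A i i) * x i = ∑ j ∈ univ.erase i, (A i j : ℂ) * x j := by
    have h := congrFun hx i
    rw [sub_mulVec, smul_mulVec, one_mulVec, Pi.sub_apply, mulVec, dotProduct,
      ← add_sum_erase _ _ (mem_univ i)] at h
    simp only [map_apply, Pi.smul_apply, smul_eq_mul, Pi.zero_apply] at h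
    linear_combination -h
  have hdiag := hAv i
  rw [mulVec, dotProduct, ← add_sum_erase _ _ (mem_univ i)] at hdiag
  have hnorm : ‖z - A i i‖ * (r * v i) ≤ (A i i - t) * (r * v i) := by
    calc ‖z - A i i‖ * (r * v i) = ‖∑ j ∈ univ.erase i, (A i j : ℂ) * x j‖ := by
          rw [← hxir, ← norm_mul, hsum]
      _ ≤ ∑ j ∈ univ.erase i, r * (-(A i j * v j)) := by
          refine norm_sum_le_of_le _ fun j hj => ?_
          have hj' := hA i j (ne_of_mem_erase hj).symm
          rw [norm_mul, Complex.norm_real, Real.norm_of_nonpos hj']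
          nlinarith [mul_le_mul_of_nonneg_left (hxr j) (neg_nonneg.2 hj')]
      _ = r * -(∑ j ∈ univ.erase i, A i j * v j) := by rw [← mul_sum, sum_neg_distrib]
      _ ≤ r * ((A i i - t) * v i) := by
          refine mul_le_mul_of_nonneg_left ?_ hxi.le
          linarith
      _ = (A i i - t) * (r * v i) := by ring
  have h := le_of_mul_le_mul_right hnorm (mul_pos hxi (hv i))
  have hre := (abs_le.1 ((Complex.abs_re_le_norm _).trans h)).1
  simp only [Complex.sub_re, Complex.ofReal_re] at hre
  linarith

/-- If the off-diagonal entries of `A` are nonpositive, its row sums are nonnegative, and `A` has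
no real eigenvalue below `μ`, then for each `t < μ` there is a positive `v` with `t v ≤ A v`. -/
theorem exists_pos_smul_le_mulVec {ι : Type*} [Fintype ι] [DecidableEq ι]
    {A : Matrix ι ι ℝ} (hA : ∀ i j, i ≠ j → A i j ≤ 0) (hrow : ∀ i, 0 ≤ ∑ j, A i j)
    {μ : ℝ} (hμ : ∀ t < μ, (A - t • 1).det ≠ 0) {t : ℝ} (ht : t < μ) :
    ∃ v : ι → ℝ, (∀ i, 0 < v i) ∧ ∀ i, t * v i ≤ (A *ᵥ v) i := by
  let v : ℝ → ι → ℝ := fun s => (A - s • 1)⁻¹ *ᵥ 1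
  have hv : ∀ s < μ, ∀ i, (A *ᵥ v s) i = s * v s i + 1 := by
    intro s hs i
    have h : (A - s • 1) *ᵥ v s = 1 := by
      rw [mulVec_mulVec, mul_nonsing_inv _ (hμ s hs).isUnit, one_mulVec]
    have h' := congrFun h i
    rw [sub_mulVec, smul_mulVec, one_mulVec] at h'
    simp only [Pi.sub_apply, Pi.smul_apply, smul_eq_mul, Pi.one_apply] at h'
    linarith
  have hcont : ∀ s < μ, ∀ i, ContinuousAt (fun s => v s i) s := by
    intro s hs i
    have hM : Continuous fun s : ℝ => A - s • (1 : Matrix ι ι ℝ) := by fun_prop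
    have hadj : Continuous fun s : ℝ => ((A - s • (1 : Matrix ι ι ℝ)).adjugate *ᵥ 1) i :=
      (continuous_apply i).comp (hM.matrix_adjugate.matrix_mulVec continuous_const)
    have h := (hM.matrix_det.continuousAt.inv₀ (hμ s hs)).mul hadj.continuousAt
    simp only [v, inv_def, smul_mulVec, Pi.smul_apply, smul_eq_mul, Ring.inverse_eq_inv']
    exact h
  have hpos : ∀ s < μ, (∀ i, 0 ≤ v s i) → ∀ i, 0 < v s i := by
    intro s hs h i
    refine (h i).lt_of_ne' fun h0 => ?_
    have hi := hv s hs i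
    have hle : (A *ᵥ v s) i ≤ 0 := by
      refine sum_nonpos fun j _ => ?_
      rcases eq_or_ne i j with rfl | hij
      · simp [h0]
      · exact mul_nonpos_of_nonpos_of_nonneg (hA i j hij) (h j)
    rw [h0] at hi
    linarith
  have hneg : ∀ s < μ, s < 0 → ∀ i, 0 ≤ v s i := by
    intro s hs hs0 k
    obtain ⟨i, -, hi⟩ := exists_min_image univ (v s) ⟨k, mem_univ k⟩
    refine le_trans ?_ (hi k (mem_univ k))
    by_contra! hlt
    have hle : (A *ᵥ v s) i ≤ (∑ j, A i j) * v s i := by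
      rw [sum_mul]
      refine sum_le_sum fun j _ => ?_
      rcases eq_or_ne i j with rfl | hij
      · exact le_rfl
      · exact mul_le_mul_of_nonpos_left (hi j (mem_univ j)) (hA i j hij)
    nlinarith [hv s hs i, mul_nonneg (hrow i) (neg_nonneg.2 hlt.le), mul_pos_of_neg_of_neg hs0 hlt]
  have hsub : Set.Iio μ ⊆ {s | s < μ ∧ ∀ i, 0 < v s i} := by
    refine isPreconnected_Iio.subset_of_closure_inter_subset ?_ ?_ ?_
    · refine isOpen_iff_mem_nhds.2 fun s hs => ?_
      filter_upwards [Iio_mem_nhds hs.1, Filter.eventually_all.2 fun i =>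
        (hcont s hs.1 i).eventually (Ioi_mem_nhds (hs.2 i))] with r hr hr'
      exact ⟨hr, hr'⟩
    · have h1 : min μ 0 - 1 < μ := by linarith [min_le_left μ 0]
      have h2 : min μ 0 - 1 < 0 := by linarith [min_le_right μ 0]
      exact ⟨_, h1, h1, hpos _ h1 (hneg _ h1 h2)⟩
    · rintro s ⟨hs, hsμ⟩
      refine ⟨hsμ, hpos s hsμ fun i => ?_⟩
      by_contra! hlt
      obtain ⟨r, hr, hr'⟩ := ((mem_closure_iff_frequently.1 hs).and_eventually
        ((hcont s hsμ i).eventually (Iio_mem_nhds hlt))).exists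
      exact lt_asymm (hr.2 i) hr'
  refine ⟨v t, (hsub ht).2, fun i => ?_⟩
  linarith [hv t ht i]

/-- Adding a nonnegative diagonal matrix does not decrease the minimal real part of the spectrum
of a matrix with nonpositive off-diagonal entries and nonnegative row sums. -/
theorem le_re_of_mem_spectrum_add_diagonal {ι : Type*} [Fintype ι] [DecidableEq ι]
    {A : Matrix ι ι ℝ} (hA : ∀ i j, i ≠ j → A i j ≤ 0) (hrow : ∀ i, 0 ≤ ∑ j, A i j)
    {μ : ℝ} (hμ : ∀ z ∈ spectrum ℂ (A.map Complex.ofReal), μ ≤ z.re)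
    {d : ι → ℝ} (hd : ∀ i, 0 ≤ d i) {z : ℂ}
    (hz : z ∈ spectrum ℂ ((A + diagonal d).map Complex.ofReal)) : μ ≤ z.re := by
  refine le_of_forall_lt fun t ht => ?_
  obtain ⟨s, hts, hsμ⟩ := exists_between ht
  have hdet : ∀ s < μ, (A - s • 1).det ≠ 0 := fun s hs h =>
    hs.not_ge (by simpa using hμ s (ofReal_mem_spectrum_map_iff.2 h))
  obtain ⟨v, hv, hAv⟩ := exists_pos_smul_le_mulVec hA hrow hdet hsμ
  refine hts.trans_le (le_re_of_mem_spectrum_of_smul_le_mulVec (v := v) ?_ hv ?_ hz)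
  · intro i j hij
    simpa [hij] using hA i j hij
  · intro i
    rw [add_mulVec, Pi.add_apply, mulVec_diagonal]
    exact (hAv i).trans (le_add_of_nonneg_right (mul_nonneg (hd i) (hv i).le))

end Matrix

theorem lapl_apply_of_ne {m : ℕ} (W : Matrix (Fin m) (Fin m) ℝ) {i j : Fin m} (h : i ≠ j) :
    lapl W i j = -W i j := by
  simp [lapl, h]

theorem sum_lapl_apply {m : ℕ} (W : Matrix (Fin m) (Fin m) ℝ) (i : Fin m) :
    ∑ j, lapl W i j = 0 := by
  simp [lapl, Matrix.diagonal_apply]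

theorem bddBelow_re_spectrum {ι : Type*} [Fintype ι] [DecidableEq ι] (L : Matrix ι ι ℝ) :
    BddBelow {r : ℝ | ∃ z ∈ spectrum ℂ (L.map Complex.ofReal), z ≠ 0 ∧ z.re = r} := by
  refine ((Matrix.finite_spectrum (L.map Complex.ofReal)).image Complex.re).bddBelow.mono ?_
  rintro _ ⟨z, hz, -, rfl⟩
  exact ⟨z, hz, rfl⟩

/-- if the spectral gap `λ₂` of the block Laplacian
`L_W = [[L₁, 0], [-C, L₂ + D_C]]` is an eigenvalue of `L₁` (i.e. `Re λ₂ < μ`, the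
minimal eigenvalue of `L₂ + D_C`), then the spectral gap is invariant under arbitrary
nonnegative structural perturbations `Δ` in direction of the cutset. -/
theorem stmt11 {n m : ℕ}
    (W₁ : Matrix (Fin n) (Fin n) ℝ) (W₂ : Matrix (Fin m) (Fin m) ℝ)
    (hW₁nn : ∀ i j, 0 ≤ W₁ i j) (hW₁diag : ∀ i, W₁ i i = 0) (hW₁irr : Irreducible' W₁)
    (hW₂nn : ∀ i j, 0 ≤ W₂ i j) (hW₂diag : ∀ i, W₂ i i = 0) (hW₂irr : Irreducible' W₂)
    (C : Matrix (Fin m) (Fin n) ℝ)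
    (hCnn : ∀ i j, 0 ≤ C i j) (hC0 : ∃ i j, 0 < C i j)
    (μ : ℝ) (hμpos : 0 < μ)
    (hμmem : μ ∈ spectrum ℝ (lapl W₂ + Matrix.diagonal (fun i => ∑ j, C i j)))
    (hμmin : ∀ z : ℂ, z ∈ spectrum ℂ
      ((lapl W₂ + Matrix.diagonal (fun i => ∑ j, C i j)).map Complex.ofReal) → μ ≤ z.re)
    (hgap : ∃ z ∈ spectrum ℂ ((lapl W₁).map Complex.ofReal), z ≠ 0 ∧
      z.re = spectralGap (Matrix.fromBlocks (lapl W₁) 0 (-C)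
        (lapl W₂ + Matrix.diagonal (fun i => ∑ j, C i j))) ∧ z.re < μ) :
    ∀ Δ : Matrix (Fin m) (Fin n) ℝ, (∀ i j, 0 ≤ Δ i j) →
      spectralGap (Matrix.fromBlocks (lapl W₁) 0 (-(C + Δ))
        (lapl W₂ + Matrix.diagonal (fun i => ∑ j, C i j)
          + Matrix.diagonal (fun i => ∑ j, Δ i j)))
      = spectralGap (Matrix.fromBlocks (lapl W₁) 0 (-C)
          (lapl W₂ + Matrix.diagonal (fun i => ∑ j, C i j))) := by
  intro Δ hΔ
  obtain ⟨z₀, hz₀, hz₀0, hz₀gap, hz₀μ⟩ := hgap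
  set B := lapl W₂ + Matrix.diagonal (fun i => ∑ j, C i j) with hB
  have hspec : ∀ (E : Matrix (Fin m) (Fin n) ℝ) (F : Matrix (Fin m) (Fin m) ℝ),
      spectrum ℂ ((Matrix.fromBlocks (lapl W₁) 0 E F).map Complex.ofReal) =
        spectrum ℂ ((lapl W₁).map Complex.ofReal) ∪ spectrum ℂ (F.map Complex.ofReal) := by
    intro E F
    rw [Matrix.fromBlocks_map, Matrix.map_zero _ Complex.ofReal_zero,
      Matrix.spectrum_fromBlocks_zero₁₂]
  have hBoff : ∀ i j, i ≠ j → B i j ≤ 0 := by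
    intro i j hij
    simpa [hB, lapl_apply_of_ne W₂ hij, hij] using hW₂nn i j
  have hBrow : ∀ i, 0 ≤ ∑ j, B i j := by
    intro i
    simp only [hB, Matrix.add_apply, sum_add_distrib, sum_lapl_apply, Matrix.diagonal_apply,
      sum_ite_eq, mem_univ, if_true, zero_add]
    exact sum_nonneg fun j _ => hCnn i j
  refine le_antisymm ?_ ?_
  · rw [← hz₀gap]
    exact csInf_le (bddBelow_re_spectrum _) ⟨z₀, by rw [hspec]; exact Or.inl hz₀, hz₀0, rfl⟩
  · refine le_csInf ⟨_, z₀, by rw [hspec]; exact Or.inl hz₀, hz₀0, rfl⟩ ?_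
    rintro _ ⟨z, hz, hz0, rfl⟩
    rw [hspec] at hz
    rcases hz with hz | hz
    · exact csInf_le (bddBelow_re_spectrum _) ⟨z, by rw [hspec]; exact Or.inl hz, hz0, rfl⟩
    · rw [← hz₀gap]
      exact hz₀μ.le.trans (Matrix.le_re_of_mem_spectrum_add_diagonal hBoff hBrow hμmin
        (fun i => sum_nonneg fun j _ => hΔ i j) hz)
end

section
/- Let L_W = [[L₁, 0], [−C, L₂ + D_C]] be the block Laplacian of a weakly connected digraph with two strongly connected components, with spectral gap equal to the minimal eigenvalue μ > 0 of L₂ + D_C, μ not an eigenvalue of L₁, and let w, y be the entrywise positive left and right eigenvectors of L₂ + D_C for μ. Then there exists a nonnegative matrix Δ ∈ ℝ^{n×m} with s(Δ) > 0; in fact, any nonnegative Δ satisfying Δy = 1 (the all-ones vector in ℝⁿ) — for example Δ with k-th column equal to (1/y_k)·1 for one fixed k and all other columns zero — satisfies C(L₁ − μI)^{−1}Δy = −(1/μ)·C·1 and hence s(Δ) = (1/μ)·(wᵀC·1)/(wᵀy) > 0. Thus it is always possible to break the master-slave configuration in a way that favours synchronization. -/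
open Matrix Finset

/-- The first-order rate of change `s(Δ) = -wᵀ C (L₁ - μI)⁻¹ Δ y / (wᵀ y)` of the
spectral gap under a small perturbation `εΔ` in opposite direction of the cutset. -/
noncomputable def sPert {n m : ℕ} (L₁ : Matrix (Fin n) (Fin n) ℝ)
    (C : Matrix (Fin m) (Fin n) ℝ) (μ : ℝ) (w y : Fin m → ℝ)
    (Δ : Matrix (Fin n) (Fin m) ℝ) : ℝ :=
  -(w ⬝ᵥ C.mulVec ((L₁ - μ • (1 : Matrix (Fin n) (Fin n) ℝ))⁻¹.mulVec (Δ.mulVec y)))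
    / (w ⬝ᵥ y)

/-- The all-ones vector lies in the kernel of a Laplacian. -/
lemma lapl_mulVec_one {m : ℕ} (W : Matrix (Fin m) (Fin m) ℝ) :
    (lapl W).mulVec (fun _ => 1) = 0 := by
  ext i
  simp only [lapl, Matrix.sub_mulVec, Matrix.mulVec_diagonal, Pi.sub_apply, Pi.zero_apply]
  simp [Matrix.mulVec, dotProduct]

/-- The resolvent of a Laplacian at a nonzero regular point maps the all-ones vector to
`-1/μ` times itself. -/
lemma lapl_resolvent_mulVec_one {m : ℕ} (W : Matrix (Fin m) (Fin m) ℝ) {μ : ℝ} (hμ : μ ≠ 0)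
    (hspec : μ ∉ spectrum ℝ (lapl W)) :
    (lapl W - μ • (1 : Matrix (Fin m) (Fin m) ℝ))⁻¹.mulVec (fun _ => 1)
      = (-(1 / μ)) • fun _ => 1 := by
  have hunit : IsUnit (lapl W - μ • (1 : Matrix (Fin m) (Fin m) ℝ)) := by
    rw [spectrum.notMem_iff, Algebra.algebraMap_eq_smul_one] at hspec
    simpa using hspec.neg
  have hone : (lapl W - μ • (1 : Matrix (Fin m) (Fin m) ℝ)).mulVec
      ((-(1 / μ)) • fun _ => 1) = fun _ => 1 := by
    rw [Matrix.mulVec_smul, Matrix.sub_mulVec, lapl_mulVec_one, Matrix.smul_mulVec,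
      Matrix.one_mulVec]
    ext i
    simp [hμ]
  have hinv := congrArg (lapl W - μ • (1 : Matrix (Fin m) (Fin m) ℝ))⁻¹.mulVec hone
  rwa [Matrix.mulVec_mulVec, Matrix.nonsing_inv_mul _
    ((Matrix.isUnit_iff_isUnit_det _).mp hunit), Matrix.one_mulVec, eq_comm] at hinv

/-- A positive vector pairs positively with the row sums of a nonzero nonnegative matrix. -/
lemma dotProduct_mulVec_one_pos {m n : ℕ} {C : Matrix (Fin m) (Fin n) ℝ}
    (hC : ∀ i j, 0 ≤ C i j) (hC0 : ∃ i j, 0 < C i j) {w : Fin m → ℝ} (hw : ∀ i, 0 < w i) :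
    0 < w ⬝ᵥ C.mulVec (fun _ => 1) := by
  obtain ⟨i, j, hij⟩ := hC0
  simp only [dotProduct, Matrix.mulVec, mul_one]
  exact Finset.sum_pos'
    (fun a _ => mul_nonneg (hw a).le (Finset.sum_nonneg fun b _ => hC a b))
    ⟨i, Finset.mem_univ i, mul_pos (hw i)
      (Finset.sum_pos' (fun b _ => hC i b) ⟨j, Finset.mem_univ j, hij⟩)⟩

/-- in the master-slave setting there always exists a nonnegative
perturbation `Δ` in opposite direction of the cutset with `s(Δ) > 0`; in fact any
nonnegative `Δ` with `Δ y = 1` satisfies `C (L₁ - μI)⁻¹ Δ y = -(1/μ) C 1` and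
`s(Δ) = (1/μ)(wᵀ C 1)/(wᵀ y) > 0`, and such `Δ` exist (e.g. with `k`-th column
`(1/y k)·1` and all other columns zero). -/
theorem stmt13 {n m : ℕ}
    (W₁ : Matrix (Fin n) (Fin n) ℝ) (W₂ : Matrix (Fin m) (Fin m) ℝ)
    (hW₁nn : ∀ i j, 0 ≤ W₁ i j) (hW₁diag : ∀ i, W₁ i i = 0) (hW₁irr : Irreducible' W₁)
    (hW₂nn : ∀ i j, 0 ≤ W₂ i j) (hW₂diag : ∀ i, W₂ i i = 0) (hW₂irr : Irreducible' W₂)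
    (C : Matrix (Fin m) (Fin n) ℝ)
    (hCnn : ∀ i j, 0 ≤ C i j) (hC0 : ∃ i j, 0 < C i j)
    (μ : ℝ) (w y : Fin m → ℝ)
    (hμpos : 0 < μ)
    (hμmin : ∀ z : ℂ, z ∈ spectrum ℂ
      ((lapl W₂ + Matrix.diagonal (fun i => ∑ j, C i j)).map Complex.ofReal) → μ ≤ z.re)
    (hw : ∀ i, 0 < w i) (hy : ∀ i, 0 < y i)
    (hwEig : Matrix.vecMul w (lapl W₂ + Matrix.diagonal (fun i => ∑ j, C i j)) = μ • w)
    (hyEig : (lapl W₂ + Matrix.diagonal (fun i => ∑ j, C i j)).mulVec y = μ • y)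
    (hμL₁ : μ ∉ spectrum ℝ (lapl W₁))
    (hgap : spectralGap (Matrix.fromBlocks (lapl W₁) 0 (-C)
      (lapl W₂ + Matrix.diagonal (fun i => ∑ j, C i j))) = μ) :
    (∃ Δ : Matrix (Fin n) (Fin m) ℝ, (∀ i j, 0 ≤ Δ i j) ∧
      0 < sPert (lapl W₁) C μ w y Δ) ∧
    (∀ Δ : Matrix (Fin n) (Fin m) ℝ, (∀ i j, 0 ≤ Δ i j) →
      Δ.mulVec y = (fun _ => 1) →
      C.mulVec (((lapl W₁) - μ • (1 : Matrix (Fin n) (Fin n) ℝ))⁻¹.mulVec (Δ.mulVec y))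
          = (-(1 / μ)) • C.mulVec (fun _ => 1) ∧
        sPert (lapl W₁) C μ w y Δ = (1 / μ) * (w ⬝ᵥ C.mulVec (fun _ => 1)) / (w ⬝ᵥ y) ∧
        0 < sPert (lapl W₁) C μ w y Δ) ∧
    (∀ k : Fin m,
      (∀ i j, 0 ≤ Matrix.of (fun (_ : Fin n) (j : Fin m) => if j = k then 1 / y k else 0) i j) ∧
      (Matrix.of (fun (_ : Fin n) (j : Fin m) => if j = k then 1 / y k else 0)).mulVec y
        = (fun _ => 1)) := by
  have hsingle : ∀ k : Fin m,
      (∀ i j, 0 ≤ Matrix.of (fun (_ : Fin n) (j : Fin m) => if j = k then 1 / y k else 0) i j) ∧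
      (Matrix.of (fun (_ : Fin n) (j : Fin m) => if j = k then 1 / y k else 0)).mulVec y
        = (fun _ => 1) := by
    refine fun k => ⟨fun i j => ?_, ?_⟩
    · simp only [Matrix.of_apply]
      split_ifs
      · exact (one_div_pos.mpr (hy k)).le
      · exact le_rfl
    · ext i
      simp [Matrix.mulVec, dotProduct, (hy k).ne']
  have hrate : ∀ Δ : Matrix (Fin n) (Fin m) ℝ, (∀ i j, 0 ≤ Δ i j) →
      Δ.mulVec y = (fun _ => 1) →
      C.mulVec (((lapl W₁) - μ • (1 : Matrix (Fin n) (Fin n) ℝ))⁻¹.mulVec (Δ.mulVec y))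
          = (-(1 / μ)) • C.mulVec (fun _ => 1) ∧
        sPert (lapl W₁) C μ w y Δ = (1 / μ) * (w ⬝ᵥ C.mulVec (fun _ => 1)) / (w ⬝ᵥ y) ∧
        0 < sPert (lapl W₁) C μ w y Δ := by
    intro Δ _ hΔy
    have hC : C.mulVec (((lapl W₁) - μ • (1 : Matrix (Fin n) (Fin n) ℝ))⁻¹.mulVec (Δ.mulVec y))
        = (-(1 / μ)) • C.mulVec (fun _ => 1) := by
      rw [hΔy, lapl_resolvent_mulVec_one W₁ hμpos.ne' hμL₁, Matrix.mulVec_smul]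
    have hs : sPert (lapl W₁) C μ w y Δ
        = (1 / μ) * (w ⬝ᵥ C.mulVec (fun _ => 1)) / (w ⬝ᵥ y) := by
      rw [sPert, hC, dotProduct_smul, smul_eq_mul, neg_mul, neg_neg]
    refine ⟨hC, hs, ?_⟩
    obtain ⟨i, -⟩ := id hC0
    have hwy : 0 < w ⬝ᵥ y :=
      Finset.sum_pos (fun a _ => mul_pos (hw a) (hy a)) ⟨i, Finset.mem_univ i⟩
    rw [hs]
    exact div_pos (mul_pos (one_div_pos.mpr hμpos) (dotProduct_mulVec_one_pos hCnn hC0 hw)) hwy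
  obtain ⟨k, -⟩ := id hC0
  exact ⟨⟨_, (hsingle k).1, (hrate _ (hsingle k).1 (hsingle k).2).2.2⟩, hrate, hsingle⟩
end

section
/- Let L_W = [[L₁, 0], [−C, L₂ + D_C]] be the block Laplacian of a weakly connected digraph with two strongly connected components, where L₁ is diagonalizable over ℂ and additionally has zero column sums (1ᵀL₁ = 0), the spectral gap of L_W equals the minimal eigenvalue μ > 0 of L₂ + D_C, μ is not an eigenvalue of L₁, and w, y are the entrywise positive left and right eigenvectors of L₂ + D_C for μ. Then there exists a constant δ(L₁) > 0, depending only on L₁, such that whenever 0 < μ < δ(L₁), one has s(Δ) > 0 for every nonnegative nonzero matrix Δ ∈ ℝ^{n×m}: every structural perturbation in opposite direction of the cutset enhances the synchronizability. -/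
open Matrix Finset

theorem lapl_mulVec_apply {n : ℕ} (W : Matrix (Fin n) (Fin n) ℝ) (x : Fin n → ℝ) (i : Fin n) :
    (lapl W).mulVec x i = ∑ j, W i j * (x i - x j) := by
  rw [lapl, Matrix.sub_mulVec, Pi.sub_apply, Matrix.mulVec_diagonal, Finset.sum_mul]
  simp only [Matrix.mulVec, dotProduct, mul_sub, Finset.sum_sub_distrib]

/-- Vectors in the kernel of the Laplacian of a strongly connected digraph are constant. -/
theorem eq_of_lapl_mulVec_eq_zero {n : ℕ} {W : Matrix (Fin n) (Fin n) ℝ}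
    (hnn : ∀ i j, 0 ≤ W i j) (hirr : Irreducible' W) {x : Fin n → ℝ}
    (hx : (lapl W).mulVec x = 0) (i j : Fin n) : x i = x j := by
  obtain ⟨a, -, ha⟩ := Finset.exists_max_image Finset.univ x ⟨i, Finset.mem_univ i⟩
  have step : ∀ k l, x k = x a → 0 < W k l → x l = x a := by
    intro k l hk hkl
    have h0 := congrFun hx k
    rw [lapl_mulVec_apply, Pi.zero_apply, Finset.sum_eq_zero_iff_of_nonneg] at h0
    · have := h0 l (Finset.mem_univ l)
      rcases mul_eq_zero.mp this with h | h <;> linarith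
    · intro l _
      exact mul_nonneg (hnn k l) (by linarith [ha l (Finset.mem_univ l)])
  have reach : ∀ (p : ℕ) (k l : Fin n), x k = x a → 0 < (W ^ p) k l → x l = x a := by
    intro p
    induction p with
    | zero =>
      intro k l hk hkl
      rcases eq_or_ne k l with rfl | hne
      · exact hk
      · simp [Matrix.one_apply_ne hne] at hkl
    | succ p ih =>
      intro k l hk hkl
      rw [pow_succ', Matrix.mul_apply] at hkl
      obtain ⟨b, -, hb⟩ := Finset.exists_lt_of_sum_lt (s := Finset.univ)
        (f := fun _ : Fin n => (0 : ℝ)) (by simpa using hkl)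
      have hWb : 0 < W k b := (hnn k b).lt_of_ne (by intro h; simp [← h] at hb)
      exact ih b l (step k b hk hWb) (pos_of_mul_pos_right hb hWb.le)
  have key : ∀ k, x k = x a := by
    intro k
    rcases eq_or_ne a k with rfl | hne
    · rfl
    · obtain ⟨p, hp⟩ := hirr a k hne
      exact reach p a k rfl hp
  rw [key i, key j]

theorem sum_mulVec_eq_zero {n : ℕ} {L : Matrix (Fin n) (Fin n) ℝ}
    (hcol : Matrix.vecMul (fun _ => (1 : ℝ)) L = 0) (x : Fin n → ℝ) :
    ∑ i, L.mulVec x i = 0 := by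
  have h := Matrix.dotProduct_mulVec (fun _ : Fin n => (1 : ℝ)) L x
  simpa [hcol, dotProduct] using h

/-- The Laplacian of a balanced strongly connected digraph is bounded below, in the sup norm, on
vectors with zero sum. -/
theorem exists_bound_of_sum_eq_zero {n : ℕ} {W : Matrix (Fin n) (Fin n) ℝ}
    (hnn : ∀ i j, 0 ≤ W i j) (hirr : Irreducible' W)
    (hcol : Matrix.vecMul (fun _ => (1 : ℝ)) (lapl W) = 0) :
    ∃ K : ℝ, 0 < K ∧ ∀ (z : Fin n → ℝ) (c : ℝ), ∑ i, z i = 0 →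
      (∀ i, |(lapl W).mulVec z i| ≤ c) → ∀ i, |z i| ≤ K * c := by
  set M : Matrix (Fin n) (Fin n) ℝ := lapl W + Matrix.of fun _ _ => 1 with hM
  have hMz : ∀ z, M.mulVec z = (lapl W).mulVec z + fun _ => ∑ i, z i := by
    intro z
    ext i
    simp [hM, Matrix.mulVec, dotProduct, add_mul, Finset.sum_add_distrib]
  have hinj : Function.Injective M.mulVec := by
    intro z₁ z₂ h
    have h0 : M.mulVec (z₁ - z₂) = 0 := by rw [Matrix.mulVec_sub]; exact sub_eq_zero.mpr h
    generalize hz : z₁ - z₂ = z at h0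
    rw [hMz] at h0
    suffices z = 0 from sub_eq_zero.mp (hz.trans this)
    ext i
    have hn : (0 : ℝ) < n := by exact_mod_cast i.pos
    have hs : (n : ℝ) * ∑ i, z i = 0 := by
      have h1 : ∑ j, ((lapl W).mulVec z j + ∑ i, z i) = 0 :=
        Finset.sum_eq_zero fun j _ => congrFun h0 j
      rw [Finset.sum_add_distrib, sum_mulVec_eq_zero hcol] at h1
      simpa using h1
    have hs0 : ∑ i, z i = 0 := (mul_eq_zero.mp hs).resolve_left hn.ne'
    have hL : (lapl W).mulVec z = 0 := by
      rw [hs0] at h0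
      exact (add_zero _).symm.trans h0
    have hsum : ∑ j, z j = n * z i := by
      rw [Finset.sum_congr rfl fun j _ => eq_of_lapl_mulVec_eq_zero hnn hirr hL j i]
      simp
    exact (mul_eq_zero.mp (hsum.symm.trans hs0)).resolve_left hn.ne'
  have hunit : IsUnit M := Matrix.mulVec_injective_iff_isUnit.mp hinj
  have hpos : ∀ i j, 0 ≤ |M⁻¹ i j| := fun i j => abs_nonneg _
  refine ⟨1 + ∑ i, ∑ j, |M⁻¹ i j|, by positivity, fun z c hz hc i => ?_⟩
  have hc0 : 0 ≤ c := (abs_nonneg _).trans (hc i)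
  have hzi : z = M⁻¹.mulVec ((lapl W).mulVec z) := by
    have h1 : M.mulVec z = (lapl W).mulVec z := by
      rw [hMz, hz]
      exact add_zero _
    rw [← h1, Matrix.mulVec_mulVec,
      Matrix.nonsing_inv_mul _ ((Matrix.isUnit_iff_isUnit_det M).mp hunit), Matrix.one_mulVec]
  calc |z i| = |∑ j, M⁻¹ i j * (lapl W).mulVec z j| := congrArg abs (congrFun hzi i)
    _ ≤ ∑ j, |M⁻¹ i j * (lapl W).mulVec z j| := Finset.abs_sum_le_sum_abs _ _
    _ ≤ ∑ j, |M⁻¹ i j| * c := Finset.sum_le_sum fun j _ => by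
        rw [abs_mul]
        exact mul_le_mul_of_nonneg_left (hc j) (hpos i j)
    _ = (∑ j, |M⁻¹ i j|) * c := by rw [Finset.sum_mul]
    _ ≤ (1 + ∑ i, ∑ j, |M⁻¹ i j|) * c := by
        refine mul_le_mul_of_nonneg_right ?_ hc0
        have : ∑ j, |M⁻¹ i j| ≤ ∑ i, ∑ j, |M⁻¹ i j| :=
          Finset.single_le_sum (f := fun i => ∑ j, |M⁻¹ i j|)
          (fun k _ => Finset.sum_nonneg fun j _ => hpos k j) (Finset.mem_univ i)
        linarith

/-- For a balanced strongly connected digraph with Laplacian `L` and small `μ > 0`, solutions of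
`(L - μ) x = v` with `v` nonnegative and nonzero are entrywise negative. -/
theorem exists_forall_neg_of_lapl_mulVec_eq {n : ℕ} {W : Matrix (Fin n) (Fin n) ℝ}
    (hnn : ∀ i j, 0 ≤ W i j) (hirr : Irreducible' W)
    (hcol : Matrix.vecMul (fun _ => (1 : ℝ)) (lapl W) = 0) :
    ∃ δ : ℝ, 0 < δ ∧ ∀ (μ : ℝ) (x v : Fin n → ℝ), 0 < μ → μ < δ → (∀ i, 0 ≤ v i) → v ≠ 0 →
      (lapl W).mulVec x = μ • x + v → ∀ i, x i < 0 := by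
  obtain ⟨K, hK, hbound⟩ := exists_bound_of_sum_eq_zero hnn hirr hcol
  refine ⟨1 / (2 * K * (n + 1)), by positivity, fun μ x v hμ hμδ hv hv0 hx i => ?_⟩
  have hn : (1 : ℝ) ≤ n := by exact_mod_cast i.pos
  have hn0 : (n : ℝ) ≠ 0 := by positivity
  rw [lt_div_iff₀ (by positivity)] at hμδ
  set S := ∑ j, v j with hS
  have hvS : ∀ j, v j ≤ S := fun j =>
    Finset.single_le_sum (fun k _ => hv k) (Finset.mem_univ j)
  have hSpos : 0 < S := by
    obtain ⟨j, hj⟩ := Function.ne_iff.mp hv0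
    exact ((hv j).lt_of_ne' hj).trans_le (hvS j)
  have hsum : μ * ∑ j, x j + S = 0 := by
    have h := sum_mulVec_eq_zero hcol x
    rw [hx] at h
    simpa [Finset.sum_add_distrib, Finset.mul_sum] using h
  set t := S / (n * μ) with ht
  have htS : t * (n * μ) = S := div_mul_cancel₀ _ (by positivity)
  set z : Fin n → ℝ := fun j => x j + t with hz
  have hz0 : ∑ j, z j = 0 := by
    have : μ * ∑ j, z j = 0 := by
      simp only [hz, Finset.sum_add_distrib, Finset.sum_const, Finset.card_univ, Fintype.card_fin,
        nsmul_eq_mul]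
      linarith
    exact (mul_eq_zero.mp this).resolve_left hμ.ne'
  have hLz : ∀ j, (lapl W).mulVec z j = μ * z j + (v j - S / n) := by
    intro j
    have h1 : (lapl W).mulVec z j = (lapl W).mulVec x j := by
      simp [lapl_mulVec_apply, hz]
    have h2 : μ * t = S / n := by rw [ht]; field_simp
    rw [h1, hx, ← h2]
    simp only [Pi.add_apply, Pi.smul_apply, smul_eq_mul, hz]
    ring
  obtain ⟨a, -, ha⟩ := Finset.exists_max_image Finset.univ (fun j => |z j|) ⟨i, Finset.mem_univ i⟩
  have hSn : S / n ≤ S := div_le_self hSpos.le hn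
  have hSn0 : 0 ≤ S / n := by positivity
  have hza : |z a| ≤ K * (μ * |z a| + S) := by
    refine hbound z _ hz0 (fun j => ?_) a
    rw [hLz]
    refine (abs_add_le _ _).trans (add_le_add ?_ ?_)
    · rw [abs_mul, abs_of_pos hμ]
      exact mul_le_mul_of_nonneg_left (ha j (Finset.mem_univ j)) hμ.le
    · rw [abs_le]
      constructor <;> linarith [hv j, hvS j]
  have hKμ : K * μ ≤ 1 / 2 := by nlinarith [mul_pos hK hμ]
  have hza' : |z a| ≤ 2 * K * S := by nlinarith [abs_nonneg (z a)]
  have hlt : 2 * K * S < t := by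
    rw [ht, lt_div_iff₀ (by positivity)]
    nlinarith [mul_pos hK hμ]
  have hzi : z i ≤ |z a| := (le_abs_self _).trans (ha i (Finset.mem_univ i))
  have : x i = z i - t := by simp [hz]
  linarith

/-- for a diagonalizable zero-column-sum Laplacian `L₁` of a strongly connected weighted
digraph, there is a constant `δ(L₁) > 0`, depending
only on `L₁`, such that in every master-slave configuration whose spectral gap is the
minimal eigenvalue `μ` of `L₂ + D_C` with `0 < μ < δ(L₁)`, every nonzero nonnegative
perturbation `Δ` in opposite direction of the cutset satisfies `s(Δ) > 0`. -/
theorem stmt16 {n : ℕ} (W₁ : Matrix (Fin n) (Fin n) ℝ)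
    (hW₁nn : ∀ i j, 0 ≤ W₁ i j) (hW₁diag : ∀ i, W₁ i i = 0) (hW₁irr : Irreducible' W₁)
    (hdiag : ∃ (P : Matrix (Fin n) (Fin n) ℂ) (d : Fin n → ℂ),
      IsUnit P.det ∧ (lapl W₁).map Complex.ofReal = P * Matrix.diagonal d * P⁻¹)
    (hcol : Matrix.vecMul (fun _ => (1 : ℝ)) (lapl W₁) = 0) :
    ∃ δ : ℝ, 0 < δ ∧
      ∀ (m : ℕ) (W₂ : Matrix (Fin m) (Fin m) ℝ) (C : Matrix (Fin m) (Fin n) ℝ)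
        (μ : ℝ) (w y : Fin m → ℝ),
        (∀ i j, 0 ≤ W₂ i j) → (∀ i, W₂ i i = 0) → Irreducible' W₂ →
        (∀ i j, 0 ≤ C i j) → (∃ i j, 0 < C i j) →
        0 < μ → μ < δ →
        (∀ z : ℂ, z ∈ spectrum ℂ
          ((lapl W₂ + Matrix.diagonal (fun i => ∑ j, C i j)).map Complex.ofReal) →
          μ ≤ z.re) →
        (∀ i, 0 < w i) → (∀ i, 0 < y i) →
        Matrix.vecMul w (lapl W₂ + Matrix.diagonal (fun i => ∑ j, C i j)) = μ • w →
        (lapl W₂ + Matrix.diagonal (fun i => ∑ j, C i j)).mulVec y = μ • y →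
        μ ∉ spectrum ℝ (lapl W₁) →
        spectralGap (Matrix.fromBlocks (lapl W₁) 0 (-C)
          (lapl W₂ + Matrix.diagonal (fun i => ∑ j, C i j))) = μ →
        ∀ Δ : Matrix (Fin n) (Fin m) ℝ, (∀ i j, 0 ≤ Δ i j) → Δ ≠ 0 →
          0 < sPert (lapl W₁) C μ w y Δ := by
  obtain ⟨δ, hδ, hneg⟩ := exists_forall_neg_of_lapl_mulVec_eq hW₁nn hW₁irr hcol
  refine ⟨δ, hδ, ?_⟩
  intro m W₂ C μ w y _ _ _ hC hCpos hμ hμδ _ hw hy _ _ hspec _ Δ hΔ hΔ0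
  obtain ⟨a, b, hab⟩ := hCpos
  have hunit : IsUnit (lapl W₁ - μ • (1 : Matrix (Fin n) (Fin n) ℝ)) := by
    have h := spectrum.notMem_iff.mp hspec
    rw [Algebra.algebraMap_eq_smul_one] at h
    simpa using h.neg
  set v := Δ.mulVec y with hv
  have hvnn : ∀ i, 0 ≤ v i := fun i =>
    dotProduct_nonneg_of_nonneg (hΔ i) fun j => (hy j).le
  have hv0 : v ≠ 0 := by
    intro h
    apply hΔ0
    ext i j
    have h1 : ∑ j, Δ i j * y j = 0 := congrFun h i
    rw [Finset.sum_eq_zero_iff_of_nonneg fun j _ => mul_nonneg (hΔ i j) (hy j).le] at h1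
    exact (mul_eq_zero.mp (h1 j (Finset.mem_univ j))).resolve_right (hy j).ne'
  set x := (lapl W₁ - μ • (1 : Matrix (Fin n) (Fin n) ℝ))⁻¹.mulVec v with hx
  have hLx : (lapl W₁).mulVec x = μ • x + v := by
    have h : (lapl W₁ - μ • (1 : Matrix (Fin n) (Fin n) ℝ)).mulVec x = v := by
      rw [hx, Matrix.mulVec_mulVec,
        Matrix.mul_nonsing_inv _ ((Matrix.isUnit_iff_isUnit_det _).mp hunit), Matrix.one_mulVec]
    rw [Matrix.sub_mulVec, Matrix.smul_mulVec, Matrix.one_mulVec] at h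
    rw [← h]
    abel
  have hxneg := hneg μ x v hμ hμδ hvnn hv0 hLx
  have hterm : ∀ i j, C i j * x j ≤ 0 := fun i j =>
    mul_nonpos_of_nonneg_of_nonpos (hC i j) (hxneg j).le
  have hCx : ∀ i, C.mulVec x i ≤ 0 := fun i => by
    rw [Matrix.mulVec, dotProduct]
    exact Finset.sum_nonpos fun j _ => hterm i j
  have hCxa : C.mulVec x a < 0 :=
    Finset.sum_neg' (fun j _ => hterm a j)
      ⟨b, Finset.mem_univ b, mul_neg_of_pos_of_neg hab (hxneg b)⟩
  have hnum : w ⬝ᵥ C.mulVec x < 0 :=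
    Finset.sum_neg' (fun i _ => mul_nonpos_of_nonneg_of_nonpos (hw i).le (hCx i))
      ⟨a, Finset.mem_univ a, mul_neg_of_pos_of_neg (hw a) hCxa⟩
  have hden : 0 < w ⬝ᵥ y :=
    Finset.sum_pos (fun i _ => mul_pos (hw i) (hy i)) ⟨a, Finset.mem_univ a⟩
  exact div_pos (neg_pos.mpr hnum) hden
end

section
/- Let L₁ ∈ ℝ^{n×n} be the diagonalizable Laplacian of a strongly connected weighted digraph (L₁·1 = 0, 0 a simple eigenvalue, all nonzero eigenvalues with positive real part), let μ > 0 not be an eigenvalue of L₁, and suppose L₁ has a real eigenvalue α > μ with a real eigenvector X. Set β_M = max_i X_i and β_m = max(0, max_i(−X_i)), and let i₀ be an index with X_{i₀} = β_M. Then: (1) if β_m > 0 and α < (β_M/β_m + 1)·μ, the vector u = β_m·1 + X is entrywise nonnegative and ((L₁ − μI)^{−1}u)_{i₀} = (1/μ)(−β_m + β_M/(α/μ − 1)) > 0; consequently, in the master-slave setting with spectral gap μ of L_W equal to the minimal eigenvalue of L₂ + D_C and positive eigenvectors w, y, for any cutset C whose positive entries lie only in column i₀ and any nonnegative Δ ∈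 ℝ^{n×m} with Δy = u, one has s(Δ) = −wᵀC(L₁ − μI)^{−1}Δy/(wᵀy) ≤ 0; (2) if X is entrywise nonnegative (β_m = 0), then (L₁ − μI)^{−1}X = X/(α − μ) is entrywise nonnegative, and for every such cutset C and any nonnegative Δ with Δy = X one has s(Δ) ≤ 0. Thus breaking the master-slave configuration can hinder synchronization. -/
open Matrix Finset

/-- The constant vectors lie in the kernel of a graph Laplacian. -/
theorem lapl_mulVec_const {m : ℕ} (W : Matrix (Fin m) (Fin m) ℝ) (c : ℝ) :
    (lapl W).mulVec (fun _ => c) = 0 := by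
  ext i
  rw [lapl, sub_mulVec, Pi.sub_apply, mulVec_diagonal]
  simp [mulVec, dotProduct, Finset.sum_mul]

/-- If `μ` is not an eigenvalue of `A`, the resolvent equation `A v - μ v = u` determines
`(A - μI)⁻¹ u`. -/
theorem inv_sub_smul_one_mulVec {ι : Type*} [Fintype ι] [DecidableEq ι] {A : Matrix ι ι ℝ}
    {μ : ℝ} (hμ : μ ∉ spectrum ℝ A) {u v : ι → ℝ} (h : A.mulVec v - μ • v = u) :
    (A - μ • (1 : Matrix ι ι ℝ))⁻¹.mulVec u = v := by
  have hunit : IsUnit (A - μ • (1 : Matrix ι ι ℝ)) := by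
    rw [spectrum.notMem_iff, Algebra.algebraMap_eq_smul_one] at hμ
    simpa using hμ.neg
  have huv : (A - μ • (1 : Matrix ι ι ℝ)).mulVec v = u := by
    rw [sub_mulVec, smul_mulVec, one_mulVec, h]
  rw [← huv, mulVec_mulVec, nonsing_inv_mul _ ((isUnit_iff_isUnit_det _).1 hunit), one_mulVec]

/-- A cutset leaving from the single node `i₀` only sees the `i₀`-entry of
`(L₁ - μI)⁻¹ Δ y`; if that entry is nonnegative, then `s(Δ) ≤ 0`. -/
theorem sPert_nonpos {n m : ℕ} {L₁ : Matrix (Fin n) (Fin n) ℝ} {C : Matrix (Fin m) (Fin n) ℝ}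
    {μ : ℝ} {w y : Fin m → ℝ} {Δ : Matrix (Fin n) (Fin m) ℝ} {i₀ : Fin n}
    (hC : ∀ i j, 0 ≤ C i j) (hCi₀ : ∀ j i, 0 < C j i → i = i₀)
    (hw : ∀ i, 0 < w i) (hy : ∀ i, 0 < y i)
    (h : 0 ≤ ((L₁ - μ • (1 : Matrix (Fin n) (Fin n) ℝ))⁻¹.mulVec (Δ.mulVec y)) i₀) :
    sPert L₁ C μ w y Δ ≤ 0 := by
  refine div_nonpos_of_nonpos_of_nonneg (neg_nonpos.2 ?_)
    (Finset.sum_nonneg fun i _ => (mul_pos (hw i) (hy i)).le)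
  refine Finset.sum_nonneg fun j _ => mul_nonneg (hw j).le ?_
  rw [mulVec, dotProduct]
  refine Finset.sum_nonneg fun i _ => ?_
  rcases (hC j i).eq_or_lt with h0 | hpos
  · rw [← h0, zero_mul]
  · obtain rfl := hCi₀ j i hpos
    exact mul_nonneg hpos.le h

/-- breaking the master-slave configuration can hinder synchronization:
`L₁` is the diagonalizable Laplacian of a strongly connected weighted digraph, `μ > 0`
is not an eigenvalue of `L₁`, and `α > μ` is a real eigenvalue of `L₁` with real
eigenvector `X`; `βM = max_i X i` (attained at `i₀`) and `βm = max(0, max_i (-X i))`.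
(1) If `βm > 0` and `α < (βM/βm + 1)·μ`, the vector `u = βm·1 + X` is entrywise
nonnegative, `((L₁ - μI)⁻¹ u)_{i₀} = (1/μ)(-βm + βM/(α/μ - 1)) > 0`, and in the
master-slave setting with spectral gap `μ`, for any cutset `C` whose positive entries
lie only in column `i₀` and any nonnegative `Δ` with `Δy = u`, one has `s(Δ) ≤ 0`.
(2) If `X` is entrywise nonnegative, then `(L₁ - μI)⁻¹ X = X/(α - μ)` is entrywise
nonnegative and for every such cutset `C` and nonnegative `Δ` with `Δy = X` one has
`s(Δ) ≤ 0`. -/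
theorem stmt17 {n : ℕ} (W₁ : Matrix (Fin n) (Fin n) ℝ)
    (hW₁nn : ∀ i j, 0 ≤ W₁ i j) (hW₁diag : ∀ i, W₁ i i = 0) (hW₁irr : Irreducible' W₁)
    (hdiag : ∃ (P : Matrix (Fin n) (Fin n) ℂ) (d : Fin n → ℂ),
      IsUnit P.det ∧ (lapl W₁).map Complex.ofReal = P * Matrix.diagonal d * P⁻¹)
    (h0simple : Polynomial.rootMultiplicity 0 (lapl W₁).charpoly = 1)
    (hposspec : ∀ z : ℂ, z ∈ spectrum ℂ ((lapl W₁).map Complex.ofReal) → z ≠ 0 → 0 < z.re)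
    (μ : ℝ) (hμpos : 0 < μ) (hμL₁ : μ ∉ spectrum ℝ (lapl W₁))
    (α : ℝ) (X : Fin n → ℝ) (hX : (lapl W₁).mulVec X = α • X) (hXne : X ≠ 0)
    (hαμ : μ < α)
    (βM βm : ℝ) (i₀ : Fin n)
    (hβM_ub : ∀ i, X i ≤ βM) (hβMi₀ : X i₀ = βM)
    (hβm_ub : ∀ i, -X i ≤ βm) (hβm_nonneg : 0 ≤ βm)
    (hβm_mem : βm = 0 ∨ ∃ i, βm = -X i) :
    (0 < βm → α < (βM / βm + 1) * μ →
      (∀ i, 0 ≤ βm + X i) ∧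
      ((lapl W₁ - μ • (1 : Matrix (Fin n) (Fin n) ℝ))⁻¹.mulVec (fun i => βm + X i)) i₀
        = (1 / μ) * (-βm + βM / (α / μ - 1)) ∧
      0 < (1 / μ) * (-βm + βM / (α / μ - 1)) ∧
      (∀ (m : ℕ) (W₂ : Matrix (Fin m) (Fin m) ℝ) (C : Matrix (Fin m) (Fin n) ℝ)
          (w y : Fin m → ℝ) (Δ : Matrix (Fin n) (Fin m) ℝ),
        (∀ i j, 0 ≤ W₂ i j) → (∀ i, W₂ i i = 0) → Irreducible' W₂ →
        (∀ i j, 0 ≤ C i j) → C ≠ 0 → (∀ j i, 0 < C j i → i = i₀) →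
        (∀ i, 0 < w i) → (∀ i, 0 < y i) →
        Matrix.vecMul w (lapl W₂ + Matrix.diagonal (fun i => ∑ j, C i j)) = μ • w →
        (lapl W₂ + Matrix.diagonal (fun i => ∑ j, C i j)).mulVec y = μ • y →
        spectralGap (Matrix.fromBlocks (lapl W₁) 0 (-C)
          (lapl W₂ + Matrix.diagonal (fun i => ∑ j, C i j))) = μ →
        (∀ i j, 0 ≤ Δ i j) → Δ.mulVec y = (fun i => βm + X i) →
        sPert (lapl W₁) C μ w y Δ ≤ 0)) ∧
    ((∀ i, 0 ≤ X i) →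
      (lapl W₁ - μ • (1 : Matrix (Fin n) (Fin n) ℝ))⁻¹.mulVec X = (α - μ)⁻¹ • X ∧
      (∀ i, 0 ≤ ((α - μ)⁻¹ • X) i) ∧
      (∀ (m : ℕ) (W₂ : Matrix (Fin m) (Fin m) ℝ) (C : Matrix (Fin m) (Fin n) ℝ)
          (w y : Fin m → ℝ) (Δ : Matrix (Fin n) (Fin m) ℝ),
        (∀ i j, 0 ≤ W₂ i j) → (∀ i, W₂ i i = 0) → Irreducible' W₂ →
        (∀ i j, 0 ≤ C i j) → C ≠ 0 → (∀ j i, 0 < C j i → i = i₀) →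
        (∀ i, 0 < w i) → (∀ i, 0 < y i) →
        Matrix.vecMul w (lapl W₂ + Matrix.diagonal (fun i => ∑ j, C i j)) = μ • w →
        (lapl W₂ + Matrix.diagonal (fun i => ∑ j, C i j)).mulVec y = μ • y →
        spectralGap (Matrix.fromBlocks (lapl W₁) 0 (-C)
          (lapl W₂ + Matrix.diagonal (fun i => ∑ j, C i j))) = μ →
        (∀ i j, 0 ≤ Δ i j) → Δ.mulVec y = X →
        sPert (lapl W₁) C μ w y Δ ≤ 0)) := by
  have hαμ' : 0 < α - μ := sub_pos.2 hαμ
  constructor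
  · intro hβm hα
    have hentry : ((lapl W₁ - μ • (1 : Matrix (Fin n) (Fin n) ℝ))⁻¹.mulVec
        (fun i => βm + X i)) i₀ = (1 / μ) * (-βm + βM / (α / μ - 1)) := by
      have hres : (lapl W₁).mulVec ((fun _ => -(βm / μ)) + (α - μ)⁻¹ • X)
          - μ • ((fun _ => -(βm / μ)) + (α - μ)⁻¹ • X) = fun i => βm + X i := by
        rw [mulVec_add, mulVec_smul, lapl_mulVec_const, hX]
        ext i
        simp only [Pi.sub_apply, Pi.add_apply, Pi.smul_apply, Pi.zero_apply, smul_eq_mul]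
        field_simp
        ring
      rw [inv_sub_smul_one_mulVec hμL₁ hres, ← hβMi₀]
      simp only [Pi.add_apply, Pi.smul_apply, smul_eq_mul]
      field_simp
    have hpos : 0 < (1 / μ) * (-βm + βM / (α / μ - 1)) := by
      have hlt : α / μ - 1 < βM / βm := by
        rw [sub_lt_iff_lt_add, div_lt_iff₀ hμpos]
        exact hα
      have h0 : 0 < α / μ - 1 := by
        rw [sub_pos, one_lt_div hμpos]
        exact hαμ
      refine mul_pos (one_div_pos.2 hμpos) ?_
      rw [neg_add_eq_sub, sub_pos, lt_div_iff₀ h0, mul_comm]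
      exact (lt_div_iff₀ hβm).1 hlt
    refine ⟨fun i => by linarith [hβm_ub i], hentry, hpos, ?_⟩
    intro m W₂ C w y Δ _ _ _ hC _ hCi₀ hw hy _ _ _ _ hΔy
    refine sPert_nonpos hC hCi₀ hw hy ?_
    rw [hΔy, hentry]
    exact hpos.le
  · intro hX0
    have hres : (lapl W₁ - μ • (1 : Matrix (Fin n) (Fin n) ℝ))⁻¹.mulVec X
        = (α - μ)⁻¹ • X := by
      refine inv_sub_smul_one_mulVec hμL₁ ?_
      rw [mulVec_smul, hX, smul_comm μ, ← smul_sub, ← sub_smul, inv_smul_smul₀ hαμ'.ne']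
    have hnn : ∀ i, 0 ≤ ((α - μ)⁻¹ • X) i := fun i =>
      mul_nonneg (inv_nonneg.2 hαμ'.le) (hX0 i)
    refine ⟨hres, hnn, ?_⟩
    intro m W₂ C w y Δ _ _ _ hC _ hCi₀ hw hy _ _ _ _ hΔy
    refine sPert_nonpos hC hCi₀ hw hy ?_
    rw [hΔy, hres]
    exact hnn i₀
end
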